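/- Let m and k be positive natural numbers, v ∈ ℝ^m, and a_1,…,a_k and b_1,…,b_k positive real numbers. Let Z be the vector field on ℝ^m × ℝ^k defined by Z(s,u) = (v, (−a_j·b_j·tanh(a_j·u_j))_j). If c : ℝ → ℝ^m × ℝ^k is differentiable with c′(t) = Z(c(t)) for all t and the ℝ^k-component of c(0) is 0, then the ℝ^k-component of c(t) is 0 for all t ∈ ℝ, i.e. c(t) = (s₀ + t·v, 0) where s₀ is the ℝ^m-component of c(0). -/

import Mathlib

theorem eq_zero_of_hasDerivAt_neg_tanh {α β : ℝ} (hα : α ≠ 0) {y : ℝ → ℝ}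
    (hy : ∀ t, HasDerivAt y (-(α * β * Real.tanh (α * y t))) t) (h0 : y 0 = 0) (t : ℝ) :
    y t = 0 := by
  have hderiv (s : ℝ) :
      HasDerivAt (fun s ↦ Real.sinh (α * y s) * Real.exp (α ^ 2 * β * s)) 0 s := by
    have hsinh := ((hy s).const_mul α).sinh
    have hexp := ((hasDerivAt_id' s).const_mul (α ^ 2 * β)).exp
    refine (hsinh.mul hexp).congr_deriv ?_
    have hcosh := (Real.cosh_pos (α * y s)).ne'
    rw [Real.tanh_eq_sinh_div_cosh]
    field_simp
    ring
  have hconst := is_const_of_deriv_eq_zero (fun s ↦ (hderiv s).differentiableAt)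
    (fun s ↦ (hderiv s).deriv) t 0
  simpa [h0, hα, Real.exp_ne_zero] using hconst

theorem eq_add_smul_of_hasDerivAt_const {E : Type*} [NormedAddCommGroup E] [NormedSpace ℝ E]
    {f : ℝ → E} {v : E} (hf : ∀ t, HasDerivAt f v t) (t : ℝ) : f t = f 0 + t • v := by
  have hderiv (s : ℝ) : HasDerivAt (fun s ↦ f s - s • v) 0 s :=
    ((hf s).sub ((hasDerivAt_id' s).smul_const v)).congr_deriv (by simp)
  have hconst := is_const_of_deriv_eq_zero (fun s ↦ (hderiv s).differentiableAt)
    (fun s ↦ (hderiv s).deriv) t 0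
  simpa [sub_eq_iff_eq_add] using hconst

/-- Invariance of the subspace `{u = 0}`: an integral curve of
`Z(s,u) = (v, (−a_j·b_j·tanh(a_j·u_j))_j)` whose `ℝ^k`-component vanishes at `t = 0`
satisfies `c(t) = ((c 0).1 + t • v, 0)` for all `t`. -/
theorem stmt_11 (m k : ℕ) (hm : 0 < m) (hk : 0 < k)
    (v : EuclideanSpace ℝ (Fin m)) (a b : Fin k → ℝ)
    (ha : ∀ j, 0 < a j) (hb : ∀ j, 0 < b j)
    (Z : EuclideanSpace ℝ (Fin m) × EuclideanSpace ℝ (Fin k) →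
      EuclideanSpace ℝ (Fin m) × EuclideanSpace ℝ (Fin k))
    (hZ : ∀ p, (Z p).1 = v ∧ ∀ j, (Z p).2 j = -(a j * b j * Real.tanh (a j * p.2 j)))
    (c : ℝ → EuclideanSpace ℝ (Fin m) × EuclideanSpace ℝ (Fin k))
    (hc : ∀ t, HasDerivAt c (Z (c t)) t) (h0 : (c 0).2 = 0) :
    ∀ t, c t = ((c 0).1 + t • v, 0) := by
  intro t
  have hfst (s : ℝ) : HasDerivAt (fun t ↦ (c t).1) v s := by
    rw [← (hZ (c s)).1]
    exact (hasFDerivAt_fst (𝕜 := ℝ) (p := c s)).comp_hasDerivAt s (hc s)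
  have hsnd (s : ℝ) : HasDerivAt (fun t ↦ (c t).2) (Z (c s)).2 s :=
    (hasFDerivAt_snd (𝕜 := ℝ) (p := c s)).comp_hasDerivAt s (hc s)
  refine Prod.ext (eq_add_smul_of_hasDerivAt_const hfst t) ?_
  ext j
  refine eq_zero_of_hasDerivAt_neg_tanh (β := b j) (ha j).ne' (y := fun t ↦ (c t).2 j)
    (fun s ↦ ?_) (by simp [h0]) t
  rw [← (hZ (c s)).2 j]
  exact (EuclideanSpace.proj (𝕜 := ℝ) j).hasFDerivAt.comp_hasDerivAt s (hsnd s)
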